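/- Let S_1, ..., S_k be nonempty 0-dimensional simplicial complexes, let X = S_1 ∗ ... ∗ S_k be their join (so X is (k−2)-connected), let Δ be a maximal (k−1)-simplex of X with vertices s_i ∈ S_i for 1 ≤ i ≤ k, and let Y be X with the interior of Δ removed. If the inclusion ∂Δ → Y is nullhomotopic, then Y is (k−2)-connected. -/

import Mathlib

/-- A point of the join `S_1 ∗ ⋯ ∗ S_k` of the `0`-dimensional complexes with
vertex sets `S i`: a convex combination of vertices using at most one vertex
from each factor. -/
def JoinPt {k : ℕ} (S : Fin k → Type) (f : (Σ i, S i) → ℝ) : Prop :=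
  (∀ v, 0 ≤ f v) ∧ (∑ᶠ v, f v = 1) ∧
    ∀ (i : Fin k) (a b : S i), f ⟨i, a⟩ ≠ 0 → f ⟨i, b⟩ ≠ 0 → a = b

/-- The vertex set of the maximal `(k-1)`-simplex `Δ` with vertices `s i ∈ S i`. -/
def DeltaV {k : ℕ} (S : Fin k → Type) (s : ∀ i, S i) : Set (Σ i, S i) :=
  Set.range fun i => (⟨i, s i⟩ : Σ i, S i)

/-- `Y`: the join `X = S_1 ∗ ⋯ ∗ S_k` with the (open) interior of the maximal
simplex `Δ` removed. -/
def Yspace {k : ℕ} (S : Fin k → Type) (s : ∀ i, S i) : Set ((Σ i, S i) → ℝ) :=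
  {f | JoinPt S f ∧ ¬(∀ v, f v ≠ 0 ↔ v ∈ DeltaV S s)}

/-- The boundary sphere `∂Δ` of the maximal simplex `Δ`: points supported on a
proper subset of the vertices of `Δ`. -/
def BoundaryDelta {k : ℕ} (S : Fin k → Type) (s : ∀ i, S i) : Set ((Σ i, S i) → ℝ) :=
  {f | JoinPt S f ∧ (∀ v, f v ≠ 0 → v ∈ DeltaV S s) ∧ ∃ i : Fin k, f ⟨i, s i⟩ = 0}

lemma boundaryDelta_subset_Y {k : ℕ} (S : Fin k → Type) (s : ∀ i, S i) :
    BoundaryDelta S s ⊆ Yspace S s := by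
  rintro f ⟨hJ, hsupp, i, hi⟩
  exact ⟨hJ, fun hall => (hall ⟨i, s i⟩).mpr ⟨i, rfl⟩ hi⟩

/-- The inclusion `∂Δ → Y`. -/
def inclBoundary {k : ℕ} (S : Fin k → Type) (s : ∀ i, S i) :
    C(BoundaryDelta S s, Yspace S s) :=
  ⟨Set.inclusion (boundaryDelta_subset_Y S s),
    continuous_inclusion (boundaryDelta_subset_Y S s)⟩

/-- `X` is `m`-connected: nonempty, path-connected, and `π_i X = 0` for `1 ≤ i ≤ m`.
For `m = -1` this just means nonempty; for `m < -1` it is vacuous. -/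
def NConnectedSpace (m : ℤ) (X : Type*) [TopologicalSpace X] : Prop :=
  (-1 ≤ m → Nonempty X) ∧ (0 ≤ m → PathConnectedSpace X) ∧
    ∀ i : ℕ, 0 < i → (i : ℤ) ≤ m → ∀ x : X, Subsingleton (HomotopyGroup (Fin i) X x)

open Topology

/-- The join, as a subtype of functions on the vertices. -/
abbrev XJ {k : ℕ} (S : Fin k → Type) : Type := {f : (Σ i, S i) → ℝ // JoinPt S f}

/-- Two points are compatible when their supports jointly use one vertex per colour. -/
def Compat {k : ℕ} {S : Fin k → Type} (p q : (Σ i, S i) → ℝ) : Prop :=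
  ∀ (l : Fin k) (a b : S l), p ⟨l, a⟩ ≠ 0 → q ⟨l, b⟩ ≠ 0 → a = b

lemma JoinPt.finite {k : ℕ} {S : Fin k → Type} {p : (Σ i, S i) → ℝ} (hp : JoinPt S p) :
    (Function.support p).Finite := by
  by_contra h
  have := finsum_of_infinite_support h
  rw [hp.2.1] at this
  exact one_ne_zero this

lemma Compat.symm {k : ℕ} {S : Fin k → Type} {p q : (Σ i, S i) → ℝ} (h : Compat p q) :
    Compat q p := fun l a b ha hb => (h l b a hb ha).symm

lemma JoinPt.compat {k : ℕ} {S : Fin k → Type} {p : (Σ i, S i) → ℝ} (hp : JoinPt S p) :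
    Compat p p := hp.2.2

lemma joinPt_blend {k : ℕ} {S : Fin k → Type} {p q : (Σ i, S i) → ℝ} (hp : JoinPt S p)
    (hq : JoinPt S q) {t : ℝ} (h0 : 0 ≤ t) (h1 : t ≤ 1) (hc : t ≠ 0 → Compat p q) :
    JoinPt S (fun v => (1 - t) * p v + t * q v) := by
  refine ⟨fun v => ?_, ?_, fun l a b ha hb => ?_⟩
  · have := hp.1 v; have := hq.1 v
    have : 0 ≤ 1 - t := by linarith
    positivity
  · rw [finsum_add_distrib, ← mul_finsum, ← mul_finsum, hp.2.1, hq.2.1]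
    · ring
    · exact hp.finite.subset (fun v hv h => hv (by simp [h]))
    · exact hq.finite.subset (fun v hv h => hv (by simp [h]))
  · by_cases ht : t = 0
    · subst ht
      simp at ha hb
      exact hp.2.2 l a b ha hb
    · have hc := hc ht
      have key : ∀ c, (1 - t) * p ⟨l, c⟩ + t * q ⟨l, c⟩ ≠ 0 → p ⟨l, c⟩ ≠ 0 ∨ q ⟨l, c⟩ ≠ 0 := by
        intro c hc
        by_contra! h
        simp [h] at hc
      rcases key a ha with ha | ha <;> rcases key b hb with hb | hb
      · exact hp.2.2 l a b ha hb
      · exact hc l a b ha hb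
      · exact (hc l b a hb ha).symm
      · exact hq.2.2 l a b ha hb

/-- Continuous blending of two families of points. -/
def blend {k : ℕ} {S : Fin k → Type} {K : Type} [TopologicalSpace K] (p q : C(K, XJ S))
    (t : C(K, ℝ)) (ht : ∀ y, t y ∈ Set.Icc (0 : ℝ) 1)
    (hc : ∀ y, t y ≠ 0 → Compat (p y).1 (q y).1) : C(K, XJ S) where
  toFun y := ⟨fun v => (1 - t y) * (p y).1 v + t y * (q y).1 v,
    joinPt_blend (p y).2 (q y).2 (ht y).1 (ht y).2 (hc y)⟩
  continuous_toFun := by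
    refine Continuous.subtype_mk (continuous_pi fun v => ?_) _
    have h1 : Continuous fun y => (p y).1 v :=
      (continuous_apply v).comp (continuous_subtype_val.comp p.continuous)
    have h2 : Continuous fun y => (q y).1 v :=
      (continuous_apply v).comp (continuous_subtype_val.comp q.continuous)
    have h3 := t.continuous
    fun_prop

lemma blend_val {k : ℕ} {S : Fin k → Type} {K : Type} [TopologicalSpace K] (p q : C(K, XJ S))
    (t : C(K, ℝ)) (ht : ∀ y, t y ∈ Set.Icc (0 : ℝ) 1)
    (hc : ∀ y, t y ≠ 0 → Compat (p y).1 (q y).1) (y : K) (v) :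
    (blend p q t ht hc y).1 v = (1 - t y) * (p y).1 v + t y * (q y).1 v := rfl

lemma compat_blend {k : ℕ} {S : Fin k → Type} {K : Type} [TopologicalSpace K] (p q : C(K, XJ S))
    (t : C(K, ℝ)) (ht : ∀ y, t y ∈ Set.Icc (0 : ℝ) 1)
    (hc : ∀ y, t y ≠ 0 → Compat (p y).1 (q y).1) (y : K) (r : (Σ i, S i) → ℝ)
    (h1 : Compat (p y).1 r) (h2 : t y ≠ 0 → Compat (q y).1 r) :
    Compat (blend p q t ht hc y).1 r := by
  intro l a b ha hb
  rw [blend_val] at ha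
  by_cases hp : (p y).1 ⟨l, a⟩ = 0
  · have : t y ≠ 0 ∧ (q y).1 ⟨l, a⟩ ≠ 0 := by
      constructor <;> intro h <;> simp [h, hp] at ha
    exact h2 this.1 l a b this.2 hb
  · exact h1 l a b hp hb

/-- Pointwise compatible maps are homotopic relative to their coincidence set. -/
lemma homotopicRel_of_compat {k : ℕ} {S : Fin k → Type} {K : Type} [TopologicalSpace K]
    (p q : C(K, XJ S)) (hc : ∀ y, Compat (p y).1 (q y).1) (A : Set K)
    (hA : ∀ y ∈ A, p y = q y) : p.HomotopicRel q A := by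
  let B : C(unitInterval × K, XJ S) :=
    blend (p.comp ⟨Prod.snd, continuous_snd⟩) (q.comp ⟨Prod.snd, continuous_snd⟩)
      ⟨fun z => (z.1 : ℝ), by fun_prop⟩ (fun z => z.1.2) (fun z _ => hc z.2)
  have hB : ∀ t y v, (B (t, y)).1 v = (1 - (t : ℝ)) * (p y).1 v + t * (q y).1 v :=
    fun _ _ _ => rfl
  refine ⟨⟨⟨B, fun y => ?_, fun y => ?_⟩, fun t y hy => ?_⟩⟩
  · ext v
    exact (hB _ _ _).trans (by simp)
  · ext v
    exact (hB _ _ _).trans (by simp)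
  · ext v
    refine (hB t y v).trans ?_
    rw [← hA y hy]; ring

open Classical in
/-- The function with weights `w` at the vertices `c`. -/
noncomputable def mkPt {k : ℕ} {S : Fin k → Type} (w : Fin k → ℝ) (c : ∀ l, S l) :
    (Σ i, S i) → ℝ := fun v => if c v.1 = v.2 then w v.1 else 0

lemma mkPt_self {k : ℕ} {S : Fin k → Type} (w : Fin k → ℝ) (c : ∀ l, S l) (l) :
    mkPt w c ⟨l, c l⟩ = w l := by simp [mkPt]

lemma mkPt_ne {k : ℕ} {S : Fin k → Type} {w : Fin k → ℝ} {c : ∀ l, S l} {l a}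
    (h : mkPt w c ⟨l, a⟩ ≠ 0) : c l = a ∧ w l ≠ 0 := by
  by_cases h' : c l = a
  · simp [mkPt, h'] at h
    exact ⟨h', h⟩
  · simp [mkPt, h'] at h

lemma finsum_section {k : ℕ} {S : Fin k → Type} (p : (Σ i, S i) → ℝ) (c : ∀ l, S l)
    (h : ∀ l a, p ⟨l, a⟩ ≠ 0 → c l = a) : ∑ᶠ v, p v = ∑ l, p ⟨l, c l⟩ := by
  let e : Fin k ↪ (Σ i, S i) := ⟨fun l => ⟨l, c l⟩, fun a b hab => congrArg Sigma.fst hab⟩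
  rw [finsum_eq_sum_of_support_subset (s := Finset.univ.map e)]
  · rw [Finset.sum_map]; rfl
  · rintro ⟨l, a⟩ hv
    have := h l a hv
    subst this
    exact Finset.mem_coe.2 (Finset.mem_map.2 ⟨l, Finset.mem_univ _, rfl⟩)

lemma joinPt_mkPt {k : ℕ} {S : Fin k → Type} {w : Fin k → ℝ} {c : ∀ l, S l}
    (h0 : ∀ l, 0 ≤ w l) (h1 : ∑ l, w l = 1) : JoinPt S (mkPt w c) := by
  refine ⟨fun v => ?_, ?_, fun l a b ha hb => (mkPt_ne ha).1.symm.trans (mkPt_ne hb).1⟩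
  · unfold mkPt; split_ifs
    · exact h0 _
    · exact le_rfl
  · rw [finsum_section _ c (fun l a h => (mkPt_ne h).1)]
    simpa only [mkPt_self] using h1

/-- The vertex `a` of colour `j`. -/
noncomputable def vtx {k : ℕ} {S : Fin k → Type} (c : ∀ l, S l) (j : Fin k) : XJ S :=
  ⟨mkPt (Pi.single j 1) c, joinPt_mkPt (fun l => by
    by_cases h : l = j
    · subst h; simp
    · simp [h]) (by simp)⟩

lemma vtx_ne {k : ℕ} {S : Fin k → Type} {c : ∀ l, S l} {j l : Fin k} {a : S l}
    (h : (vtx c j).1 ⟨l, a⟩ ≠ 0) : l = j ∧ c l = a := by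
  have := mkPt_ne h
  refine ⟨?_, this.1⟩
  by_contra h'
  simp [h'] at this

lemma JoinPt.exists_ne {k : ℕ} {S : Fin k → Type} {p : (Σ i, S i) → ℝ} (hp : JoinPt S p) :
    ∃ l a, p ⟨l, a⟩ ≠ 0 := by
  by_contra! h
  have : p = 0 := by ext ⟨l, a⟩; exact h l a
  have h1 := hp.2.1
  simp [this] at h1

lemma joined_of_compat {k : ℕ} {S : Fin k → Type} (p q : XJ S) (h : Compat p.1 q.1) :
    Joined p q := by
  obtain ⟨H⟩ := homotopicRel_of_compat (ContinuousMap.const Unit p) (ContinuousMap.const Unit q)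
    (fun _ => h) ∅ (by simp)
  exact ⟨⟨⟨fun t => H (t, ()), by fun_prop⟩, by simp, by simp⟩⟩

lemma pathConnected_XJ {k : ℕ} {S : Fin k → Type} (hk : 2 ≤ k) (s : ∀ i, S i) :
    PathConnectedSpace (XJ S) := by
  classical
  have hv : ∀ p : XJ S, ∃ (c : ∀ l, S l) (j : Fin k), Joined p (vtx c j) := by
    intro p
    obtain ⟨l, a, hla⟩ := p.2.exists_ne
    refine ⟨Function.update s l a, l, joined_of_compat _ _ ?_⟩
    intro m x y hx hy
    obtain ⟨rfl, hy⟩ := vtx_ne hy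
    simp at hy
    subst hy
    exact p.2.2.2 _ _ _ hx hla
  have hne : ∀ (c c' : ∀ l, S l) (j j' : Fin k), j ≠ j' → Joined (vtx c j) (vtx c' j') := by
    intro c c' j j' hj
    refine joined_of_compat _ _ fun m x y hx hy => ?_
    exact absurd ((vtx_ne hx).1.symm.trans (vtx_ne hy).1) hj
  refine ⟨⟨vtx s ⟨0, by omega⟩⟩, fun p q => ?_⟩
  obtain ⟨c, j, h⟩ := hv p
  obtain ⟨c', j', h'⟩ := hv q
  refine h.trans (Joined.trans ?_ h'.symm)
  by_cases hj : j = j'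
  · have : Nontrivial (Fin k) := Fin.nontrivial_iff_two_le.2 hk
    obtain ⟨m, hm⟩ := exists_ne j
    exact (hne c s j m hm.symm).trans (hne s c' m j' (hj ▸ hm))
  · exact hne _ _ _ _ hj

lemma JoinPt.exists_gt {k : ℕ} {S : Fin k → Type} {p : (Σ i, S i) → ℝ} (hp : JoinPt S p)
    {δ : ℝ} (h0 : 0 < δ) (hδ : k * δ < 1) : ∃ v, δ < p v := by
  by_contra! h
  have h1 := hp.2.1
  rw [finsum_eq_sum_of_support_subset (s := hp.finite.toFinset) _ (by simp)] at h1
  have h2 : ∑ v ∈ hp.finite.toFinset, p v ≤ hp.finite.toFinset.card • δ :=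
    Finset.sum_le_card_nsmul _ _ _ (fun v _ => h v)
  have h3 : hp.finite.toFinset.card ≤ (Finset.univ : Finset (Fin k)).card := by
    refine Finset.card_le_card_of_injOn Sigma.fst (fun _ _ => by simp) ?_
    rintro ⟨l, a⟩ ha ⟨m, b⟩ hb (hlm : l = m)
    subst hlm
    simp at ha hb
    rw [hp.2.2 l a b ha hb]
  simp only [Finset.card_univ, Fintype.card_fin] at h3
  rw [nsmul_eq_mul] at h2
  have h4 : (hp.finite.toFinset.card : ℝ) ≤ k := by exact_mod_cast h3
  nlinarith

lemma JoinPt.sum_le {k : ℕ} {S : Fin k → Type} {p : (Σ i, S i) → ℝ} (hp : JoinPt S p)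
    (T : Finset (Σ i, S i)) : ∑ v ∈ T, p v ≤ 1 := by
  classical
  rw [← hp.2.1, finsum_eq_sum_of_support_subset (s := hp.finite.toFinset ∪ T) _
    (fun v hv => by simp at hv ⊢; exact Or.inl hv)]
  exact Finset.sum_le_sum_of_subset_of_nonneg Finset.subset_union_right (fun v _ _ => hp.1 v)

lemma coord_cont {k : ℕ} {S : Fin k → Type} {K : Type} [TopologicalSpace K] (f : C(K, XJ S))
    (v) : Continuous fun y => (f y).1 v :=
  (continuous_apply v).comp (continuous_subtype_val.comp f.continuous)

lemma local_supp {k : ℕ} {S : Fin k → Type} {K : Type} [TopologicalSpace K] (f : C(K, XJ S))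
    {δ : ℝ} (hδ : 0 < δ) (z : K) :
    ∃ O : Set K, IsOpen O ∧ z ∈ O ∧ ∀ y ∈ O, ∀ u, δ < (f y).1 u → (f z).1 u ≠ 0 := by
  classical
  let T := (f z).2.finite.toFinset
  refine ⟨{y | 1 - δ < ∑ v ∈ T, (f y).1 v}, ?_, ?_, ?_⟩
  · exact isOpen_lt continuous_const (continuous_finsetSum _ fun v _ => coord_cont f v)
  · have : ∑ v ∈ T, (f z).1 v = 1 := by
      rw [← (f z).2.2.1, finsum_eq_sum_of_support_subset (s := T) _ (by simp [T])]
    simp [this, hδ]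
  · intro y hy u hu hz
    have huT : u ∉ T := by simp [T, hz]
    have := (f y).2.sum_le (insert u T)
    rw [Finset.sum_insert huT] at this
    have hy : 1 - δ < ∑ v ∈ T, (f y).1 v := hy
    linarith

/-- Truncating the small coordinates and renormalizing. -/
lemma exists_shr {k : ℕ} {S : Fin k → Type} {K : Type} [TopologicalSpace K] (f : C(K, XJ S))
    {δ : ℝ} (h0 : 0 < δ) (hδ : k * δ < 1) :
    ∃ g : C(K, XJ S), ∀ y v, (g y).1 v ≠ 0 ↔ δ < (f y).1 v := by
  let h : (Σ i, S i) → K → ℝ := fun v y => max ((f y).1 v - δ) 0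
  have hne : ∀ v y, h v y ≠ 0 ↔ δ < (f y).1 v := by
    intro v y
    constructor
    · intro hh
      by_contra! hc
      exact hh (max_eq_right (by linarith))
    · intro hh
      exact ne_of_gt (lt_of_lt_of_le (by linarith) (le_max_left _ _))
  have hnn : ∀ v y, 0 ≤ h v y := fun v y => le_max_right _ _
  have hcont : ∀ v, Continuous (h v) := fun v => by
    have := coord_cont f v
    fun_prop
  have hfin : ∀ y, (Function.support fun v => h v y).Finite := fun y =>
    (f y).2.finite.subset fun v hv => by
      have := (hne v y).1 hv
      exact ne_of_gt (by linarith)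
  have hlf : LocallyFinite fun v => Function.support (h v) := by
    intro z
    obtain ⟨O, hO, hzO, hOs⟩ := local_supp f h0 z
    refine ⟨O, hO.mem_nhds hzO, (f z).2.finite.subset ?_⟩
    rintro v ⟨y, hy, hyO⟩
    exact hOs y hyO v ((hne v y).1 hy)
  have hsum : Continuous fun y => ∑ᶠ v, h v y := continuous_finsum hcont hlf
  have hpos : ∀ y, 0 < ∑ᶠ v, h v y := by
    intro y
    obtain ⟨v, hv⟩ := (f y).2.exists_gt h0 hδ
    exact finsum_pos (fun v => hnn v y)
      ⟨v, lt_of_le_of_ne (hnn v y) ((hne v y).2 hv).symm⟩ (hfin y)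
  have hne' : ∀ y v, (∑ᶠ v, h v y)⁻¹ * h v y ≠ 0 ↔ δ < (f y).1 v := by
    intro y v
    rw [← hne v y]
    simp [(hpos y).ne']
  refine ⟨⟨fun y => ⟨fun v => (∑ᶠ v, h v y)⁻¹ * h v y, fun v => ?_, ?_, ?_⟩, ?_⟩, hne'⟩
  · exact mul_nonneg (inv_nonneg.2 (hpos y).le) (hnn v y)
  · rw [← mul_finsum]
    exact inv_mul_cancel₀ (hpos y).ne'
  · intro l a b ha hb
    have ha := (hne' y _).1 ha
    have hb := (hne' y _).1 hb
    exact (f y).2.2.2 l a b (by linarith : (0:ℝ) < _).ne' (by linarith : (0:ℝ) < _).ne'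
  · refine Continuous.subtype_mk (continuous_pi fun v => ?_) _
    exact (hsum.inv₀ fun y => (hpos y).ne').mul (hcont v)

lemma unif_colour {k : ℕ} {S : Fin k → Type} {K : Type} [PseudoMetricSpace K] [CompactSpace K]
    (f : C(K, XJ S)) {δ : ℝ} (hδ : 0 < δ) :
    ∃ ε > 0, ∀ y y' : K, dist y' y < ε → ∀ l a b, δ < (f y).1 ⟨l, a⟩ → δ < (f y').1 ⟨l, b⟩ →
      a = b := by
  choose O hO hz hOs using local_supp f hδ
  obtain ⟨ε, he, h⟩ := lebesgue_number_lemma_of_metric (s := Set.univ) isCompact_univ hO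
    (fun z _ => Set.mem_iUnion.2 ⟨z, hz z⟩)
  refine ⟨ε, he, fun y y' hd l a b ha hb => ?_⟩
  obtain ⟨z, hzb⟩ := h y trivial
  exact (f z).2.2.2 l a b (hOs z y (hzb (Metric.mem_ball_self he)) _ ha)
    (hOs z y' (hzb hd) _ hb)

lemma ite_cont {K T : Type} [TopologicalSpace K] [DecidableEq T] (v : K → ℝ) (hv : Continuous v)
    (c : K → T) (hc : ∀ y, v y ≠ 0 → ∀ᶠ y' in 𝓝 y, c y' = c y) (a : T) :
    Continuous fun y => if c y = a then v y else 0 := by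
  rw [continuous_iff_continuousAt]
  intro y
  by_cases h : v y = 0
  · have h0 : (if c y = a then v y else 0) = 0 := by simp [h]
    unfold ContinuousAt
    beta_reduce
    rw [h0]
    refine squeeze_zero_norm (a := fun y => |v y|) (fun y => ?_) ?_
    · split_ifs <;> simp
    · have := (hv.abs).tendsto y
      simpa [h] using this
  · by_cases ha : c y = a
    · refine hv.continuousAt.congr ?_
      filter_upwards [hc y h] with y' hy'
      simp [hy', ha]
    · refine (continuousAt_const (y := (0:ℝ))).congr ?_
      filter_upwards [hc y h] with y' hy'
      simp [hy', ha]

lemma floor_const {K : Type} [TopologicalSpace K] (u : K → ℝ) (hu : Continuous u) (y : K)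
    (h : ∀ n : ℤ, (n : ℝ) ≠ u y) : ∀ᶠ y' in 𝓝 y, ⌊u y'⌋ = ⌊u y⌋ := by
  have h1 : (⌊u y⌋ : ℝ) < u y := lt_of_le_of_ne (Int.floor_le _) (h _)
  have h2 := Int.lt_floor_add_one (u y)
  filter_upwards [hu.continuousAt.eventually (lt_mem_nhds h1),
    hu.continuousAt.eventually (gt_mem_nhds h2)] with y' h3 h4
  exact Int.floor_eq_iff.2 ⟨h3.le, h4⟩

/-- Kolmogorov-type map: small boxes coloured by all colours but `j`. -/
lemma exists_box_map {k i : ℕ} (hik : i + 2 ≤ k) {S : Fin k → Type} (s : ∀ l, S l)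
    (f : C(Fin i → unitInterval, XJ S)) {δ : ℝ} (hδ : 0 < δ) (j : Fin k) :
    ∃ g : C(Fin i → unitInterval, XJ S), (∀ y a, (g y).1 ⟨j, a⟩ = 0) ∧
      ∀ y l a b, (g y).1 ⟨l, a⟩ ≠ 0 → δ < (f y).1 ⟨l, b⟩ → a = b := by
  classical
  obtain ⟨ε, he, hε⟩ := unif_colour f hδ
  obtain ⟨M, hM⟩ := exists_nat_gt (1 / ε)
  have hM0 : (0 : ℝ) < M := lt_trans (by positivity) hM
  have hk : (0 : ℝ) < k := by exact_mod_cast (by omega : 0 < k)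
  let u : Fin k → Fin i → (Fin i → unitInterval) → ℝ :=
    fun l m y => M * (y m : ℝ) + (l : ℝ) / k
  have hu : ∀ l m, Continuous (u l m) := fun l m => by fun_prop
  let β : Fin k → (Fin i → unitInterval) → (Fin i → ℤ) := fun l y m => ⌊u l m y⌋
  have hβ : ∀ l y y', β l y = β l y' → dist y' y < ε := by
    intro l y y' h
    rw [dist_pi_lt_iff he]
    intro m
    have h1 : ⌊u l m y⌋ = ⌊u l m y'⌋ := congrFun h m
    have h2 := Int.abs_sub_lt_one_of_floor_eq_floor h1
    have h3 : u l m y - u l m y' = M * ((y m : ℝ) - y' m) := by simp only [u]; ring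
    rw [h3, abs_mul, abs_of_pos hM0] at h2
    rw [dist_comm, Subtype.dist_eq, Real.dist_eq]
    have h5 : 1 < M * ε := by rwa [div_lt_iff₀ he] at hM
    nlinarith [abs_nonneg ((y m : ℝ) - y' m)]
  have hC : ∀ l (n : Fin i → ℤ), ∃ a : S l, ∀ y, β l y = n → ∀ b, δ < (f y).1 ⟨l, b⟩ → a = b := by
    intro l n
    by_cases h : ∃ y b, β l y = n ∧ δ < (f y).1 ⟨l, b⟩
    · obtain ⟨y, b, h1, h2⟩ := h
      refine ⟨b, fun y' h1' b' h2' => hε y y' (hβ l y y' (h1.trans h1'.symm)) l b b' h2 h2'⟩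
    · push Not at h
      exact ⟨s l, fun y h1 b h2 => absurd h2 (not_lt.2 (h y b h1))⟩
  choose C hC using hC
  let v : Fin k → (Fin i → unitInterval) → ℝ := fun l y =>
    if l = j then 0 else ∏ m, Real.sin (u l m y * Real.pi) ^ 2
  have hvc : ∀ l, Continuous (v l) := by
    intro l
    by_cases hl : l = j
    · simp only [v, hl, if_true]; exact continuous_const
    · simp only [v, hl, if_false]
      refine continuous_finsetProd _ fun m _ => ?_
      have := hu l m
      fun_prop
  have hv0 : ∀ l y, 0 ≤ v l y := by
    intro l y
    simp only [v]
    split_ifs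
    · exact le_rfl
    · exact Finset.prod_nonneg fun m _ => sq_nonneg _
  have hvne : ∀ l y, v l y ≠ 0 ↔ l ≠ j ∧ ∀ m, ∀ n : ℤ, (n : ℝ) ≠ u l m y := by
    intro l y
    simp only [v]
    by_cases hl : l = j
    · simp [hl]
    · simp only [hl, if_false, Finset.prod_ne_zero_iff, ne_eq, not_false_iff, true_and,
        Finset.mem_univ, forall_true_left]
      refine forall_congr' fun m => ?_
      simp [Real.sin_eq_zero_iff, Real.pi_ne_zero]
  have hpos : ∀ y, 0 < ∑ l, v l y := by
    intro y
    refine Finset.sum_pos' (fun l _ => hv0 l y) ?_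
    by_contra! h
    have h : ∀ l, l ≠ j → ∃ m, ∃ n : ℤ, (n : ℝ) = u l m y := by
      intro l hl
      by_contra! hc
      exact (hvne l y).2 ⟨hl, hc⟩ (le_antisymm (h l (Finset.mem_univ _)) (hv0 l y))
    have : Nonempty (Fin i) := by
      have : Nontrivial (Fin k) := Fin.nontrivial_iff_two_le.2 (by omega)
      obtain ⟨l, hl⟩ := exists_ne j
      exact ⟨(h l hl).choose⟩
    choose! m hm using h
    have hcard : (Finset.univ : Finset (Fin i)).card < (Finset.univ.erase j).card := by
      rw [Finset.card_erase_of_mem (Finset.mem_univ _)]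
      simp only [Finset.card_univ, Fintype.card_fin]
      omega
    obtain ⟨l, hl, l', hl', hne, hmm⟩ :=
      Finset.exists_ne_map_eq_of_card_lt_of_maps_to hcard (f := m) (fun _ _ => by simp)
    obtain ⟨n, hn⟩ := hm l (Finset.ne_of_mem_erase hl)
    obtain ⟨n', hn'⟩ := hm l' (Finset.ne_of_mem_erase hl')
    rw [← hmm] at hn'
    have h1 : ((n - n' : ℤ) : ℝ) * k = (l : ℝ) - l' := by
      push_cast
      rw [hn, hn']
      simp only [u]
      field_simp
      ring
    have h2 : (n - n') * (k : ℤ) = (l : ℤ) - l' := by exact_mod_cast h1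
    have hlk := l.2
    have hlk' := l'.2
    have h3 : n - n' = 0 := by
      by_contra hnn
      rcases lt_or_gt_of_ne hnn with h | h
      · nlinarith
      · nlinarith
    rw [h3] at h2
    apply hne
    ext
    omega
  let c : (Fin i → unitInterval) → ∀ l, S l := fun y l => C l (β l y)
  let w : (Fin i → unitInterval) → Fin k → ℝ := fun y l => (∑ l, v l y)⁻¹ * v l y
  have hw : ∀ l, Continuous fun y => w y l := fun l =>
    ((continuous_finsetSum _ fun l _ => hvc l).inv₀ fun y => (hpos y).ne').mul (hvc l)
  refine ⟨⟨fun y => ⟨mkPt (w y) (c y), joinPt_mkPt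
    (fun l => mul_nonneg (inv_nonneg.2 (hpos y).le) (hv0 l y)) ?_⟩, ?_⟩, ?_, ?_⟩
  · simp only [w]
    rw [← Finset.mul_sum]
    exact inv_mul_cancel₀ (hpos y).ne'
  · refine Continuous.subtype_mk (continuous_pi ?_) _
    rintro ⟨l, a⟩
    have := ite_cont (fun y => w y l) (hw l) (fun y => c y l) (fun y hy => ?_) a
    · refine this.congr fun y => ?_
      simp only [mkPt]
    · have hvn : v l y ≠ 0 := fun h => hy (by simp [w, h])
      have h1 := ((hvne l y).1 hvn).2
      have h2 : ∀ᶠ y' in 𝓝 y, ∀ m, ⌊u l m y'⌋ = ⌊u l m y⌋ :=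
        Filter.eventually_all.2 fun m => floor_const (u l m) (hu l m) y (h1 m)
      filter_upwards [h2] with y' hy'
      have : β l y' = β l y := funext hy'
      simp only [c, this]
  · intro y a
    by_contra h
    have := (mkPt_ne (w := w y) (c := c y) h).2
    simp [w, v] at this
  · intro y l a b ha hb
    have h1 := (mkPt_ne (w := w y) (c := c y) ha).1
    rw [← h1]
    exact hC l (β l y) y rfl b hb

lemma null_XJ {k i : ℕ} (hik : i + 2 ≤ k) {S : Fin k → Type} (s : ∀ l, S l)
    (f : C(Fin i → unitInterval, XJ S)) (x : XJ S) :
    f.HomotopicRel (ContinuousMap.const _ x) {y | f y = x} := by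
  classical
  obtain ⟨j, a, hja⟩ := x.2.exists_ne
  let T := x.2.finite.toFinset
  have hT : ∀ v, v ∈ T ↔ x.1 v ≠ 0 := by simp [T]
  have hk : (0 : ℝ) < k := by exact_mod_cast (by omega : 0 < k)
  obtain ⟨δ, h0, hδ, hδT⟩ : ∃ δ : ℝ, 0 < δ ∧ k * δ < 1 ∧ ∀ v, x.1 v ≠ 0 → δ < x.1 v := by
    have hTn : T.Nonempty := ⟨_, (hT _).2 hja⟩
    obtain ⟨v0, hv0, hmin⟩ := T.exists_min_image x.1 hTn
    have hp : 0 < x.1 v0 := lt_of_le_of_ne (x.2.1 _) ((hT _).1 hv0).symm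
    refine ⟨min (1 / (2 * k)) (x.1 v0 / 2), by positivity, ?_, fun v hv => ?_⟩
    · have h1 := min_le_left (1 / (2 * (k:ℝ))) (x.1 v0 / 2)
      have h2 : (k : ℝ) * (1 / (2 * k)) = 1 / 2 := by field_simp
      nlinarith
    · have h1 := min_le_right (1 / (2 * (k:ℝ))) (x.1 v0 / 2)
      have := hmin v ((hT v).2 hv)
      linarith
  obtain ⟨p, hp⟩ := exists_shr f h0 hδ
  obtain ⟨g, hgj, hg⟩ := exists_box_map hik s f h0 j
  let N : Set (Fin i → unitInterval) := {y | ∀ v ∈ T, δ < (f y).1 v}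
  have hN : IsOpen N := by
    have : N = ⋂ v ∈ T, {y | δ < (f y).1 v} := by ext y; simp [N]
    rw [this]
    exact isOpen_biInter_finset fun v _ => isOpen_lt continuous_const (coord_cont f v)
  have hA : IsClosed {y | f y = x} := isClosed_eq f.continuous continuous_const
  obtain ⟨κ, hκ0, hκ1, hκ⟩ := exists_continuous_zero_one_of_isClosed hN.isClosed_compl hA (by
    rw [Set.disjoint_left]
    intro y hy hyx
    apply hy
    intro v hv
    rw [show f y = x from hyx]
    exact hδT v ((hT v).1 hv))
  have hκN : ∀ y, κ y ≠ 0 → ∀ v, x.1 v ≠ 0 → δ < (f y).1 v := by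
    intro y hy v hv
    have : y ∈ N := by
      by_contra h
      exact hy (hκ0 h)
    exact this v ((hT v).2 hv)
  let X0 : C(Fin i → unitInterval, XJ S) := ContinuousMap.const _ x
  let e : XJ S := vtx (Function.update s j a) j
  have hxe : Compat x.1 e.1 := by
    intro l b c hb hc
    obtain ⟨rfl, hc⟩ := vtx_ne hc
    simp at hc
    subst hc
    exact x.2.2.2 _ _ _ hb hja
  let E : C(Fin i → unitInterval, XJ S) := ContinuousMap.const _ e
  have hfp : ∀ y, Compat (f y).1 (p y).1 := fun y l b c hb hc =>
    (f y).2.2.2 l b c hb (by have := (hp y _).1 hc; exact ne_of_gt (by linarith))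
  have hfx : ∀ y, κ y ≠ 0 → Compat (f y).1 x.1 := fun y hy l b c hb hc =>
    (f y).2.2.2 l b c hb (by have := hκN y hy _ hc; exact ne_of_gt (by linarith))
  have hpx : ∀ y, κ y ≠ 0 → Compat (p y).1 x.1 := fun y hy l b c hb hc =>
    (p y).2.2.2 l b c hb ((hp y _).2 (hκN y hy _ hc))
  have hgp : ∀ y, Compat (g y).1 (p y).1 := fun y l b c hb hc =>
    hg y l b c hb ((hp y _).1 hc)
  have hgx : ∀ y, κ y ≠ 0 → Compat (g y).1 x.1 := fun y hy l b c hb hc =>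
    hg y l b c hb (hκN y hy _ hc)
  have hge : ∀ y, Compat (g y).1 e.1 := fun y l b c hb hc => by
    obtain ⟨rfl, _⟩ := vtx_ne hc
    exact absurd (hgj y b) hb
  let f1 := blend p X0 κ hκ hpx
  let f2 := blend g X0 κ hκ hgx
  let f3 := blend E X0 κ hκ (fun y _ => hxe.symm)
  have hb1 : ∀ (q : C(Fin i → unitInterval, XJ S)) hc, ∀ y ∈ {y | f y = x},
      blend q X0 κ hκ hc y = x := by
    intro q hc y hy
    ext v
    rw [blend_val, show κ y = 1 from hκ1 hy]
    simp [X0]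
  have H1 : f.HomotopicRel f1 {y | f y = x} :=
    homotopicRel_of_compat _ _
      (fun y => (compat_blend _ _ _ _ _ _ _ (hfp y).symm (fun h => (hfx y h).symm)).symm) _
      (fun y hy => (show f y = x from hy).trans (hb1 p hpx y hy).symm)
  have H2 : f1.HomotopicRel f2 {y | f y = x} :=
    homotopicRel_of_compat _ _
      (fun y => compat_blend _ _ _ _ _ _ _
        (compat_blend _ _ _ _ _ _ _ (hgp y) (fun h => (hpx y h).symm)).symm
        (fun h => (compat_blend _ _ _ _ _ _ _ (hgx y h) (fun _ => x.2.compat)).symm)) _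
      (fun y hy => (hb1 p hpx y hy).trans (hb1 g hgx y hy).symm)
  have H3 : f2.HomotopicRel f3 {y | f y = x} :=
    homotopicRel_of_compat _ _
      (fun y => compat_blend _ _ _ _ _ _ _
        (compat_blend _ _ _ _ _ _ _ (hge y).symm (fun h => (hgx y h).symm)).symm
        (fun h => (compat_blend _ _ _ _ _ _ _ hxe.symm (fun _ => x.2.compat)).symm)) _
      (fun y hy => (hb1 g hgx y hy).trans (hb1 E _ y hy).symm)
  have H4 : f3.HomotopicRel X0 {y | f y = x} :=
    homotopicRel_of_compat _ _
      (fun y => compat_blend _ _ _ _ _ _ _ hxe.symm (fun _ => x.2.compat)) _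
      (fun y hy => hb1 E _ y hy)
  exact ((H1.trans H2).trans H3).trans H4

/-- The least barycentric coordinate with respect to `Δ`. -/
noncomputable def minC {k : ℕ} {S : Fin k → Type} (hk : (Finset.univ : Finset (Fin k)).Nonempty)
    (s : ∀ i, S i) (p : XJ S) : ℝ := Finset.univ.inf' hk fun l => p.1 ⟨l, s l⟩

lemma exists_retraction {k : ℕ} (hk : 1 ≤ k) {S : Fin k → Type} (s : ∀ i, S i)
    (hnull : (inclBoundary S s).Nullhomotopic) :
    ∃ r : C(XJ S, Yspace S s), ∀ y : Yspace S s, r ⟨y.1, y.2.1⟩ = y := by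
  classical
  obtain ⟨y0, ⟨F⟩⟩ := hnull
  have hne : (Finset.univ : Finset (Fin k)).Nonempty := ⟨⟨0, hk⟩, Finset.mem_univ _⟩
  have hk0 : (0 : ℝ) < k := by exact_mod_cast hk
  let m : XJ S → ℝ := minC hne s
  have hcc : ∀ v, Continuous fun p : XJ S => p.1 v := fun v =>
    (continuous_apply v).comp continuous_subtype_val
  have hmc : Continuous m := Continuous.finset_inf'_apply hne fun l _ => hcc ⟨l, s l⟩
  have hml : ∀ p l, m p ≤ p.1 ⟨l, s l⟩ := fun p l => Finset.inf'_le _ (Finset.mem_univ l)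
  have hmex : ∀ p, ∃ l, m p = p.1 ⟨l, s l⟩ := fun p => by
    obtain ⟨l, -, hl⟩ := Finset.exists_mem_eq_inf' hne fun l => p.1 ⟨l, s l⟩
    exact ⟨l, hl⟩
  have hm0 : ∀ p, 0 ≤ m p := fun p => by
    obtain ⟨l, hl⟩ := hmex p
    rw [hl]; exact p.2.1 _
  let D : Set (XJ S) := {p | ∀ l a, a ≠ s l → p.1 ⟨l, a⟩ = 0}
  have hDc : IsClosed D := by
    have : D = ⋂ l, ⋂ a, ⋂ (_ : a ≠ s l), {p : XJ S | p.1 ⟨l, a⟩ = 0} := by ext p; simp [D]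
    rw [this]
    exact isClosed_iInter fun l => isClosed_iInter fun a => isClosed_iInter fun _ =>
      isClosed_eq (hcc _) continuous_const
  have hD : ∀ p, 0 < m p → p ∈ D := by
    intro p hp l a ha
    by_contra h
    exact ha (p.2.2.2 l a (s l) h (lt_of_lt_of_le hp (hml p l)).ne')
  have hDsum : ∀ p ∈ D, ∑ l, p.1 ⟨l, s l⟩ = 1 := by
    intro p hp
    rw [← finsum_section p.1 s, p.2.2.1]
    intro l a h
    by_contra h'
    exact h (hp l a (Ne.symm h'))
  have hY : ∀ p : XJ S, m p ≤ 0 → p.1 ∈ Yspace S s := by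
    intro p hp
    refine ⟨p.2, fun h => ?_⟩
    obtain ⟨l, hl⟩ := hmex p
    exact (h ⟨l, s l⟩).2 ⟨l, rfl⟩ (by linarith [p.2.1 ⟨l, s l⟩])
  have hY' : ∀ p : XJ S, p.1 ∈ Yspace S s → m p ≤ 0 := by
    intro p hp
    by_contra! h
    apply hp.2
    rintro ⟨l, a⟩
    constructor
    · intro hv
      by_cases ha : a = s l
      · exact ⟨l, by rw [ha]⟩
      · exact absurd (hD p h l a ha) hv
    · rintro ⟨l', hl'⟩
      rw [← hl']
      exact (lt_of_lt_of_le h (hml p l')).ne'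
  let w : XJ S → Fin k → ℝ := fun p l => (p.1 ⟨l, s l⟩ - m p) / (1 - k * m p)
  let B : Set (XJ S) := {p | p ∈ D ∧ k * m p ≤ 1 / 2}
  have hB : ∀ p ∈ B, mkPt (w p) s ∈ BoundaryDelta S s := by
    rintro p ⟨hpD, hp⟩
    have hpos : 0 < 1 - k * m p := by linarith
    refine ⟨joinPt_mkPt (fun l => div_nonneg (by linarith [hml p l]) hpos.le) ?_, ?_, ?_⟩
    · simp only [w]
      rw [← Finset.sum_div, Finset.sum_sub_distrib, hDsum p hpD]
      simp only [Finset.sum_const, Finset.card_univ, Fintype.card_fin, nsmul_eq_mul]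
      exact div_self hpos.ne'
    · rintro ⟨l, a⟩ h
      exact ⟨l, congrArg (Sigma.mk l) (mkPt_ne h).1⟩
    · obtain ⟨l, hl⟩ := hmex p
      exact ⟨l, by rw [mkPt_self]; simp [w, hl]⟩
  let τ : XJ S → unitInterval := fun p => Set.projIcc 0 1 zero_le_one (2 * (k * m p))
  have hτ : Continuous τ := continuous_projIcc.comp (by fun_prop)
  let r : XJ S → Yspace S s := fun p =>
    if h : m p ≤ 0 then ⟨p.1, hY p h⟩ else
    if h' : k * m p ≤ 1 / 2 then F (τ p, ⟨mkPt (w p) s, hB p ⟨hD p (not_le.1 h), h'⟩⟩) else y0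
  have hrA : ContinuousOn r {p | m p ≤ 0} := by
    rw [continuousOn_iff_continuous_domRestrict]
    have : Set.domRestrict {p | m p ≤ 0} r = fun p => ⟨p.1.1, hY p.1 p.2⟩ := by
      ext p : 1
      have h : m p.1 ≤ 0 := p.2
      change r p.1 = _
      simp only [r, dif_pos h]
    rw [this]
    exact Continuous.subtype_mk (continuous_subtype_val.comp continuous_subtype_val) _
  have hrB : ContinuousOn r B := by
    rw [continuousOn_iff_continuous_domRestrict]
    have : Set.domRestrict B r = fun p => F (τ p.1, ⟨mkPt (w p.1) s, hB p.1 p.2⟩) := by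
      ext1 ⟨p, hp⟩
      change r p = _
      simp only [r]
      by_cases h : m p ≤ 0
      · have h0 : m p = 0 := le_antisymm h (hm0 p)
        have hτ0 : τ p = 0 := by
          simp only [τ, h0]
          exact Set.projIcc_of_le_left _ (by simp)
        rw [dif_pos h, hτ0, F.apply_zero]
        apply Subtype.ext
        change p.1 = mkPt (w p) s
        ext ⟨l, a⟩
        by_cases ha : a = s l
        · subst ha
          rw [mkPt_self]
          simp [w, h0]
        · rw [hp.1 l a ha]
          by_contra hh
          exact ha (mkPt_ne (Ne.symm hh)).1.symm
      · rw [dif_neg h, dif_pos hp.2]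
    rw [this]
    refine F.continuous.comp ((hτ.comp continuous_subtype_val).prodMk
      (Continuous.subtype_mk (continuous_pi ?_) _))
    rintro ⟨l, a⟩
    by_cases ha : s l = a
    · simp only [mkPt, ha, if_true, w]
      refine Continuous.div ?_ ?_ ?_
      · exact ((hcc _).sub hmc).comp continuous_subtype_val
      · exact (continuous_const.sub (continuous_const.mul hmc)).comp continuous_subtype_val
      · rintro ⟨p, hp⟩
        have := hp.2
        simp only
        intro h
        linarith
    · simp only [mkPt, ha, if_false]
      exact continuous_const
  have hrC : ContinuousOn r {p | 1 / 2 ≤ k * m p} := by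
    refine (continuousOn_const (c := y0)).congr ?_
    intro p hp
    have hp : 1 / 2 ≤ k * m p := hp
    have h1 : ¬ m p ≤ 0 := fun h => by nlinarith
    simp only [r, dif_neg h1]
    split_ifs with h
    · have hτ1 : τ p = 1 := by
        simp only [τ]
        exact Set.projIcc_of_right_le _ (by linarith)
      rw [hτ1, F.apply_one]
      rfl
    · rfl
  have hr : Continuous r := by
    rw [← continuousOn_univ]
    have hcA : IsClosed {p | m p ≤ 0} := isClosed_le hmc continuous_const
    have hkm : Continuous fun p => k * m p := continuous_const.mul hmc
    have hcB : IsClosed B := hDc.inter (isClosed_le hkm continuous_const)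
    have hcC : IsClosed {p | 1 / 2 ≤ k * m p} := isClosed_le continuous_const hkm
    refine ((hrA.union_of_isClosed hrB hcA hcB).union_of_isClosed hrC (hcA.union hcB) hcC).mono ?_
    intro p _
    by_cases h1 : m p ≤ 0
    · exact Or.inl (Or.inl h1)
    · by_cases h2 : k * m p ≤ 1 / 2
      · exact Or.inl (Or.inr ⟨hD p (not_le.1 h1), h2⟩)
      · exact Or.inr (not_le.1 h2).le
  refine ⟨⟨r, hr⟩, fun y => ?_⟩
  have := hY' ⟨y.1, y.2.1⟩ y.2
  change r _ = y
  simp only [r, dif_pos this]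

/-- Let `S_1, …, S_k` be nonempty `0`-dimensional complexes,
`X = S_1 ∗ ⋯ ∗ S_k` their join, `Δ` a maximal `(k−1)`-simplex of `X` with
vertices `s_i ∈ S_i`, and `Y` the space `X` with the interior of `Δ` removed.
If the inclusion `∂Δ → Y` is nullhomotopic, then `Y` is `(k−2)`-connected. -/
theorem Y_is_k_sub_two_connected (k : ℕ) (hk : 1 ≤ k)
    (S : Fin k → Type) (hS : ∀ i, Nonempty (S i)) (s : ∀ i, S i)
    (hnull : (inclBoundary S s).Nullhomotopic) :
    NConnectedSpace ((k : ℤ) - 2) (Yspace S s) := by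
  obtain ⟨r, hr⟩ := exists_retraction hk s hnull
  refine ⟨fun _ => ?_, fun h => ?_, fun i _ hi x => ?_⟩
  · obtain ⟨y, _⟩ := hnull
    exact ⟨y⟩
  · have := pathConnected_XJ (S := S) (by omega) s
    exact Function.Surjective.pathConnectedSpace (f := r) (fun y => ⟨_, hr y⟩) r.continuous
  · have key : ∀ f : GenLoop (Fin i) (Yspace S s) x, GenLoop.Homotopic f GenLoop.const := by
      intro f
      let ι : C(Yspace S s, XJ S) := ⟨fun y => ⟨y.1, y.2.1⟩, by fun_prop⟩
      have h := (null_XJ (by omega) s (ι.comp f.1) (ι x)).comp_continuousMap r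
      have h1 : r.comp (ι.comp f.1) = f.1 := by
        ext1 y
        exact hr _
      have h2 : r.comp (ContinuousMap.const _ (ι x)) =
          (GenLoop.const : GenLoop (Fin i) (Yspace S s) x).1 := by
        ext1 y
        exact hr _
      rw [h1, h2] at h
      obtain ⟨H⟩ := h
      refine ⟨⟨H.toHomotopy, fun t y hy => H.prop' t y ?_⟩⟩
      exact congrArg ι (f.2 y hy)
    refine ⟨fun a b => ?_⟩
    induction a using Quotient.inductionOn with
    | h a =>
      induction b using Quotient.inductionOn with
      | h b => exact Quotient.sound ((key a).trans (key b).symm)
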